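/- Let φ₀(ξ) = tanh(ξ/√2). Let ρ > 0, V, u, κ ∈ ℝ, and let φ₁ : ℝ → ℝ be twice continuously differentiable with φ₁, φ₁' and φ₁'' bounded on ℝ. Suppose that for all ξ ∈ ℝ: −ρ²·(V − u)·φ₀'(ξ) = κ·φ₀'(ξ) + φ₁''(ξ) − (3φ₀(ξ)² − 1)·φ₁(ξ). Then ρ²·(V − u) = −κ. -/

import Mathlib

open Filter Topology

theorem hasDerivAt_tanh (x : ℝ) : HasDerivAt Real.tanh (1 - Real.tanh x ^ 2) x := by
  have hc := (Real.cosh_pos x).ne'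
  have h := (Real.hasDerivAt_sinh x).div (Real.hasDerivAt_cosh x) hc
  rw [show Real.tanh = Real.sinh / Real.cosh from funext Real.tanh_eq_sinh_div_cosh]
  refine h.congr_deriv ?_
  simp only [Pi.div_apply]
  field_simp

theorem abs_tanh_lt_one (x : ℝ) : |Real.tanh x| < 1 :=
  abs_lt.2 (Real.tanh_bijOn.mapsTo (Set.mem_univ x))

theorem tendsto_tanh_atTop : Tendsto Real.tanh atTop (𝓝 1) := by
  have h : Real.tanh = fun x => 1 - 2 / (Real.exp (2 * x) + 1) := by
    funext x
    have hx := Real.exp_pos x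
    rw [Real.tanh_eq, Real.exp_neg, two_mul, Real.exp_add]
    field_simp
    ring
  have ht : Tendsto (fun x : ℝ => Real.exp (2 * x) + 1) atTop atTop :=
    tendsto_atTop_add_const_right _ _
      (Real.tendsto_exp_atTop.comp (tendsto_id.const_mul_atTop two_pos))
  rw [h]
  simpa using (ht.const_div_atTop 2).const_sub 1

theorem tendsto_tanh_atBot : Tendsto Real.tanh atBot (𝓝 (-1)) := by
  simpa [Function.comp_def] using (tendsto_tanh_atTop.comp tendsto_neg_atBot_atTop).neg

/-- Jump condition `ρ²(V − u) = −κ` on the part of the interface where the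
density is continuous (case (C2) `M_ε = 1/ε`, Lemma 2.6). -/
theorem jump_condition_on_S
    (φ₀ : ℝ → ℝ) (hφ₀ : ∀ ξ : ℝ, φ₀ ξ = Real.tanh (ξ / Real.sqrt 2))
    (ρ : ℝ) (hρ : 0 < ρ) (V u κ : ℝ)
    (φ₁ : ℝ → ℝ) (hφ₁ : ContDiff ℝ 2 φ₁)
    (hb : ∃ C : ℝ, ∀ ξ : ℝ, |φ₁ ξ| ≤ C)
    (hb' : ∃ C : ℝ, ∀ ξ : ℝ, |deriv φ₁ ξ| ≤ C)
    (hb'' : ∃ C : ℝ, ∀ ξ : ℝ, |deriv (deriv φ₁) ξ| ≤ C)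
    (heq : ∀ ξ : ℝ, -(ρ ^ 2) * (V - u) * deriv φ₀ ξ
      = κ * deriv φ₀ ξ + deriv (deriv φ₁) ξ - (3 * φ₀ ξ ^ 2 - 1) * φ₁ ξ) :
    ρ ^ 2 * (V - u) = -κ := by
  obtain rfl : φ₀ = fun ξ => Real.tanh (ξ / √2) := funext hφ₀
  obtain ⟨A, hA⟩ : ∃ A, A = -(ρ ^ 2 * (V - u) + κ) := ⟨_, rfl⟩
  set φ₀ : ℝ → ℝ := fun ξ => Real.tanh (ξ / √2) with hφ
  have h2 : √2 ^ 2 = (2 : ℝ) := Real.sq_sqrt (by norm_num)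
  have h2pos : 0 < √2 := by positivity
  have hd₀ (ξ : ℝ) : HasDerivAt φ₀ ((1 - φ₀ ξ ^ 2) / √2) ξ := by
    have h := (hasDerivAt_tanh (ξ / √2)).comp ξ ((hasDerivAt_id ξ).div_const √2)
    exact h.congr_deriv (by simp only [hφ]; ring)
  have hd₁ (ξ : ℝ) : HasDerivAt φ₁ (deriv φ₁ ξ) ξ :=
    (hφ₁.differentiable (by norm_num) ξ).hasDerivAt
  have hd₂ (ξ : ℝ) : HasDerivAt (deriv φ₁) (deriv (deriv φ₁) ξ) ξ := by
    have h : ContDiff ℝ 1 (deriv φ₁) := by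
      simpa using hφ₁.iterate_deriv' 1 1
    exact (h.differentiable (by norm_num) ξ).hasDerivAt
  -- The Wronskian-type quantity minus its explicit primitive.
  let g : ℝ → ℝ := fun ξ =>
    (1 - φ₀ ξ ^ 2) * (deriv φ₁ ξ + √2 * φ₀ ξ * φ₁ ξ) - A * (φ₀ ξ - φ₀ ξ ^ 3 / 3)
  have hg (ξ : ℝ) : HasDerivAt g 0 ξ := by
    have hp : HasDerivAt (fun x => 1 - φ₀ x ^ 2) _ ξ := ((hd₀ ξ).pow 2).const_sub 1
    have hq : HasDerivAt (fun x => deriv φ₁ x + √2 * φ₀ x * φ₁ x) _ ξ :=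
      (hd₂ ξ).add (((hd₀ ξ).const_mul √2).mul (hd₁ ξ))
    have hr : HasDerivAt (fun x => A * (φ₀ x - φ₀ x ^ 3 / 3)) _ ξ :=
      ((hd₀ ξ).sub (((hd₀ ξ).pow 3).div_const 3)).const_mul A
    refine ((hp.mul hq).sub hr).congr_deriv ?_
    have h := heq ξ
    rw [(hd₀ ξ).deriv] at h
    have h'' : deriv (deriv φ₁) ξ
        = A * ((1 - φ₀ ξ ^ 2) / √2) + (3 * φ₀ ξ ^ 2 - 1) * φ₁ ξ := by
      rw [hA]; linarith
    rw [h'']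
    push_cast
    field_simp
    ring_nf
    simp only [h2]
    ring
  have hlim {l : Filter ℝ} {s : ℝ} (hs : s ^ 2 = 1) (h : Tendsto φ₀ l (𝓝 s)) :
      Tendsto g l (𝓝 (-(A * (s - s ^ 3 / 3)))) := by
    obtain ⟨C, hC⟩ := hb
    obtain ⟨C', hC'⟩ := hb'
    have hp : Tendsto (fun ξ => 1 - φ₀ ξ ^ 2) l (𝓝 0) := by
      simpa [hs] using (h.pow 2).const_sub 1
    have hbd : ∀ ξ, ‖deriv φ₁ ξ + √2 * φ₀ ξ * φ₁ ξ‖ ≤ C' + √2 * C := by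
      intro ξ
      have ht : |φ₀ ξ| ≤ 1 := (abs_tanh_lt_one _).le
      calc ‖deriv φ₁ ξ + √2 * φ₀ ξ * φ₁ ξ‖
          ≤ |deriv φ₁ ξ| + |√2 * φ₀ ξ * φ₁ ξ| := norm_add_le _ _
        _ = |deriv φ₁ ξ| + √2 * |φ₀ ξ| * |φ₁ ξ| := by
            rw [abs_mul, abs_mul, abs_of_pos h2pos]
        _ ≤ C' + √2 * 1 * C := by
            gcongr
            exacts [hC' ξ, hC ξ]
        _ = C' + √2 * C := by ring
    have hW := hp.zero_mul_isBoundedUnder_le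
      (Filter.isBoundedUnder_of ⟨_, hbd⟩)
    simpa using hW.sub ((h.sub ((h.pow 3).div_const 3)).const_mul A)
  have hconst : g = fun _ => g 0 := funext fun ξ =>
    is_const_of_deriv_eq_zero (fun x => (hg x).differentiableAt) (fun x => (hg x).deriv) ξ 0
  have htop := hlim (by norm_num)
    (tendsto_tanh_atTop.comp (tendsto_id.atTop_div_const h2pos))
  have hbot := hlim (by norm_num)
    (tendsto_tanh_atBot.comp (tendsto_id.atBot_div_const h2pos))
  rw [hconst] at htop hbot
  have e₁ := tendsto_nhds_unique htop tendsto_const_nhds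
  have e₂ := tendsto_nhds_unique hbot tendsto_const_nhds
  linarith
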